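/- For every finite set S of points on the unit sphere {x ∈ ℝ³ : ‖x‖₂ = 1}, there exists a wake-up tree for S rooted at the origin (the center of the ball), with edge lengths measured by the Euclidean norm on ℝ³, whose makespan is at most 12.37. -/

import Mathlib

/-- `IsWakeUpTree d p₀ S parent t` : `parent` encodes a rooted spanning tree on the node
node set `{p₀} ∪ S` (each non-root node has a parent among the nodes and reaches the root
by iterating `parent`), the root `p₀` has exactly one child (when there is a non-root
node), every non-root node has at most two children, and `t v` is the sum of the
`d`-distances along the tree path from `p₀` to `v` (so the makespan of the tree is the
maximum of `t` over the nodes). -/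
def IsWakeUpTree {X : Type*} (d : X → X → ℝ) (p₀ : X) (S : Finset X)
    (parent : X → X) (t : X → ℝ) : Prop :=
  t p₀ = 0 ∧
  (∀ p ∈ S, p ≠ p₀ →
      (parent p = p₀ ∨ parent p ∈ S) ∧
      t p = t (parent p) + d (parent p) p ∧
      ∃ n : ℕ, parent^[n] p = p₀) ∧
  -- the root has at most one child
  (∀ x ∈ S, x ≠ p₀ → parent x = p₀ →
      ∀ y ∈ S, y ≠ p₀ → parent y = p₀ → x = y) ∧
  -- the root has a child as soon as there is a non-root node
  ((∃ p ∈ S, p ≠ p₀) → ∃ c ∈ S, c ≠ p₀ ∧ parent c = p₀) ∧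
  -- every non-root node has at most two children
  (∀ q ∈ S, q ≠ p₀ → ∀ x ∈ S, ∀ y ∈ S, ∀ z ∈ S,
      x ≠ p₀ → y ≠ p₀ → z ≠ p₀ →
      parent x = q → parent y = q → parent z = q →
      x = y ∨ x = z ∨ y = z)

open Classical in
/-- Two wake-up trees rooted at `c` are glued into one wake-up tree whose root `p` has `c` as its
only child. -/
theorem IsWakeUpTree.glue {X : Type*} {d : X → X → ℝ} {p c : X} {A B : Finset X}
    {f g : X → X} {t u : X → ℝ} (hpc : p ≠ c) (hpA : p ∉ A) (hpB : p ∉ B)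
    (hcA : c ∉ A) (hcB : c ∉ B) (hAB : Disjoint A B)
    (hA : IsWakeUpTree d c A f t) (hB : IsWakeUpTree d c B g u) :
    IsWakeUpTree d p (insert c (A ∪ B))
      (fun x => if x = c then p else if x ∈ A then f x else g x)
      (fun x => if x = p then 0 else if x = c then d p c else
        d p c + if x ∈ A then t x else u x) := by
  obtain ⟨tc, hA1, hA2, -, hA3⟩ := hA
  obtain ⟨uc, hB1, hB2, -, hB3⟩ := hB
  have hnA : ∀ x ∈ A, x ≠ c ∧ x ≠ p ∧ x ∉ B := fun x hx =>
    ⟨fun h => hcA (h ▸ hx), fun h => hpA (h ▸ hx), Finset.disjoint_left.1 hAB hx⟩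
  have hnB : ∀ x ∈ B, x ≠ c ∧ x ≠ p ∧ x ∉ A := fun x hx =>
    ⟨fun h => hcB (h ▸ hx), fun h => hpB (h ▸ hx), Finset.disjoint_right.1 hAB hx⟩
  set F : X → X := fun x => if x = c then p else if x ∈ A then f x else g x with hF
  have Fc : F c = p := by simp [hF]
  have FA : ∀ x ∈ A, F x = f x := fun x hx => by simp [hF, hx, (hnA x hx).1]
  have FB : ∀ x ∈ B, F x = g x := fun x hx => by
    simp [hF, (hnB x hx).1, (hnB x hx).2.2]
  have reach : ∀ (D : Finset X) (h : X → X), c ∉ D → (∀ x ∈ D, F x = h x) →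
      (∀ x ∈ D, h x = c ∨ h x ∈ D) → ∀ n, ∀ x ∈ D, h^[n] x = c → ∃ m, F^[m] x = p := by
    intro D h hcD hFh hD n
    induction n with
    | zero => exact fun x hx hxc => absurd (hxc ▸ hx) hcD
    | succ n ih =>
      intro x hx hxc
      rcases hD x hx with h1 | h1
      · exact ⟨2, by simp [hFh x hx, h1, Fc]⟩
      · obtain ⟨m, hm⟩ := ih _ h1 hxc
        exact ⟨m + 1, by simpa [hFh x hx] using hm⟩
  have FAne : ∀ x ∈ A, f x = c ∨ f x ∈ A := fun x hx => (hA1 x hx (hnA x hx).1).1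
  have FBne : ∀ x ∈ B, g x = c ∨ g x ∈ B := fun x hx => (hB1 x hx (hnB x hx).1).1
  have root : ∀ x ∈ insert c (A ∪ B), F x = p → x = c := by
    intro x hx hxp
    rcases Finset.mem_insert.1 hx with rfl | hx
    · rfl
    · rcases Finset.mem_union.1 hx with hx | hx
      · rw [FA x hx] at hxp
        rcases FAne x hx with h | h
        · exact absurd (hxp.symm.trans h) hpc
        · exact absurd (hxp ▸ h) hpA
      · rw [FB x hx] at hxp
        rcases FBne x hx with h | h
        · exact absurd (hxp.symm.trans h) hpc
        · exact absurd (hxp ▸ h) hpB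
  refine ⟨by simp, ?_, ?_, ?_, ?_⟩
  · intro x hx _
    rcases Finset.mem_insert.1 hx with rfl | hx
    · exact ⟨.inl Fc, by simp [Fc, hpc.symm], 1, Fc⟩
    · rcases Finset.mem_union.1 hx with hx | hx
      · obtain ⟨h1, h2, n, hn⟩ := hA1 x hx (hnA x hx).1
        refine ⟨?_, ?_, reach A f hcA FA FAne n x hx hn⟩
        · rw [FA x hx]
          rcases h1 with h1 | h1 <;> simp [h1]
        · rw [FA x hx]
          rcases h1 with h1 | h1
          · simp [hx, hnA x hx, h1, hpc.symm, h2, tc]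
          · simp only [hx, hnA x hx, h1, hnA _ h1, if_true, if_false, h2]
            ring
      · obtain ⟨h1, h2, n, hn⟩ := hB1 x hx (hnB x hx).1
        refine ⟨?_, ?_, reach B g hcB FB FBne n x hx hn⟩
        · rw [FB x hx]
          rcases h1 with h1 | h1 <;> simp [h1]
        · rw [FB x hx]
          rcases h1 with h1 | h1
          · simp [hnB x hx, h1, hpc.symm, h2, uc]
          · simp only [hnB x hx, hnB _ h1, if_false, h2]
            ring
  · exact fun x hx _ hxp y hy _ hyp => (root x hx hxp).trans (root y hy hyp).symm
  · exact fun _ => ⟨c, by simp, hpc.symm, Fc⟩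
  · have split : ∀ q, q ≠ p → ∀ x ∈ insert c (A ∪ B), F x = q →
        (x ∈ A ∧ f x = q) ∨ (x ∈ B ∧ g x = q) := by
      intro q hqp x hx hxq
      rcases Finset.mem_insert.1 hx with rfl | hx
      · exact absurd (hxq.symm.trans Fc) hqp
      · rcases Finset.mem_union.1 hx with hx | hx
        · exact .inl ⟨hx, FA x hx ▸ hxq⟩
        · exact .inr ⟨hx, FB x hx ▸ hxq⟩
    intro q hq hqp x hx y hy z hz _ _ _ hxq hyq hzq
    have hx' := split q hqp x hx hxq
    have hy' := split q hqp y hy hyq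
    have hz' := split q hqp z hz hzq
    rcases Finset.mem_insert.1 hq with rfl | hq
    · have eA : ∀ x ∈ A, f x = q → ∀ y ∈ A, f y = q → x = y := fun x hx hxq y hy hyq =>
        hA2 x hx (hnA x hx).1 hxq y hy (hnA y hy).1 hyq
      have eB : ∀ x ∈ B, g x = q → ∀ y ∈ B, g y = q → x = y := fun x hx hxq y hy hyq =>
        hB2 x hx (hnB x hx).1 hxq y hy (hnB y hy).1 hyq
      grind
    · rcases Finset.mem_union.1 hq with hq | hq
      · have noB : ∀ x ∈ B, g x ≠ q := fun x hx h => by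
          rcases FBne x hx with h' | h'
          · exact (hnA q hq).1 (h.symm.trans h')
          · exact (hnA q hq).2.2 (h ▸ h')
        have mA : ∀ x, (x ∈ A ∧ f x = q) ∨ (x ∈ B ∧ g x = q) → x ∈ A ∧ f x = q := fun x h =>
          h.resolve_right fun h => noB x h.1 h.2
        obtain ⟨hx, hxq⟩ := mA x hx'
        obtain ⟨hy, hyq⟩ := mA y hy'
        obtain ⟨hz, hzq⟩ := mA z hz'
        exact hA3 q hq (hnA q hq).1 x hx y hy z hz (hnA x hx).1 (hnA y hy).1 (hnA z hz).1
          hxq hyq hzq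
      · have noA : ∀ x ∈ A, f x ≠ q := fun x hx h => by
          rcases FAne x hx with h' | h'
          · exact (hnB q hq).1 (h.symm.trans h')
          · exact (hnB q hq).2.2 (h ▸ h')
        have mB : ∀ x, (x ∈ A ∧ f x = q) ∨ (x ∈ B ∧ g x = q) → x ∈ B ∧ g x = q := fun x h =>
          h.resolve_left fun h => noA x h.1 h.2
        obtain ⟨hx, hxq⟩ := mB x hx'
        obtain ⟨hy, hyq⟩ := mB y hy'
        obtain ⟨hz, hzq⟩ := mB z hz'
        exact hB3 q hq (hnB q hq).1 x hx y hy z hz (hnB x hx).1 (hnB y hy).1 (hnB z hz).1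
          hxq hyq hzq

open Classical in
/-- Sweep in the direction of increasing `θ`: the awake pair in a strip `a ≤ φ ≤ a + w` separates,
each robot taking one half of the strip and moving to the point of that half with least `θ`. The
moves in direction `θ` add up to at most `M`, and `ρ w` bounds the sum of the moves across. -/
theorem exists_isWakeUpTree_sweep {X : Type*} {d : X → X → ℝ} {θ φ : X → ℝ} {ρ : ℝ → ℝ} {M b : ℝ}
    (hρ : ∀ w, min b w + ρ (w / 2) ≤ ρ w) (hρ0 : ∀ w, 0 ≤ w → 0 ≤ ρ w)
    (S : Finset X) :
    ∀ (p : X) (a w D : ℝ), p ∉ S → (∀ x ∈ S, φ x ∈ Set.Icc a (a + w)) → (∀ x ∈ S, θ x ≤ M) →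
      (∀ x ∈ S, ∀ y ∈ S, d x y ≤ |θ x - θ y| + min b |φ x - φ y|) →
      (∀ x ∈ S, d p x ≤ θ x + D) →
      ∃ (f : X → X) (t : X → ℝ), IsWakeUpTree d p S f t ∧ ∀ x ∈ S, t x ≤ M + D + ρ w := by
  induction S using Finset.strongInduction with
  | H S ih =>
  intro p a w D hp hφ hM hd hD
  rcases S.eq_empty_or_nonempty with rfl | hne
  · exact ⟨id, 0, by simp [IsWakeUpTree], by simp⟩
  obtain ⟨c, hc, hmin⟩ := S.exists_min_image θ hne
  have hw : 0 ≤ w := by linarith [(hφ c hc).1, (hφ c hc).2]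
  have half : ∀ (T : Finset X) (a' : ℝ), T ⊆ S.erase c →
      (∀ x ∈ T, φ x ∈ Set.Icc a' (a' + w / 2)) →
      ∃ (f : X → X) (t : X → ℝ), IsWakeUpTree d c T f t ∧
        ∀ x ∈ T, t x ≤ M + (min b w - θ c) + ρ (w / 2) := by
    intro T a' hT hTφ
    have hTS : ∀ x ∈ T, x ∈ S := fun x hx => Finset.mem_of_mem_erase (hT hx)
    refine ih T (hT.trans_ssubset (Finset.erase_ssubset hc)) c a' (w / 2) _
      (fun h => Finset.notMem_erase c S (hT h)) hTφ (fun x hx => hM x (hTS x hx))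
      (fun x hx y hy => hd x (hTS x hx) y (hTS y hy)) fun x hx => ?_
    have h1 := hd c hc x (hTS x hx)
    have h2 : |φ c - φ x| ≤ w := by
      have h3 := hφ c hc
      have h4 := hφ x (hTS x hx)
      exact abs_le.2 ⟨by linarith [h3.1, h4.2], by linarith [h3.2, h4.1]⟩
    rw [abs_of_nonpos (sub_nonpos.2 (hmin x (hTS x hx)))] at h1
    linarith [min_le_min_left b h2]
  let A := (S.erase c).filter (φ · ≤ a + w / 2)
  let B := (S.erase c).filter (¬ φ · ≤ a + w / 2)
  have hAs : A ⊆ S.erase c := Finset.filter_subset _ _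
  have hBs : B ⊆ S.erase c := Finset.filter_subset _ _
  have hS : insert c (A ∪ B) = S := by
    rw [Finset.filter_union_filter_not_eq, Finset.insert_erase hc]
  obtain ⟨f, t, hf, ht⟩ := half A a hAs fun x hx =>
    ⟨(hφ x (Finset.mem_of_mem_erase (hAs hx))).1, (Finset.mem_filter.1 hx).2⟩
  obtain ⟨g, u, hg, hu⟩ := half B (a + w / 2) hBs fun x hx =>
    ⟨(not_le.1 (Finset.mem_filter.1 hx).2).le,
      by linarith [(hφ x (Finset.mem_of_mem_erase (hBs hx))).2]⟩
  have hpc : p ≠ c := fun h => hp (h ▸ hc)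
  have key := hf.glue hpc (fun h => hp (Finset.mem_of_mem_erase (hAs h)))
    (fun h => hp (Finset.mem_of_mem_erase (hBs h))) (fun h => Finset.notMem_erase c S (hAs h))
    (fun h => Finset.notMem_erase c S (hBs h)) (Finset.disjoint_filter_filter_not _ _ _) hg
  rw [hS] at key
  refine ⟨_, _, key, fun x hx => ?_⟩
  have h1 := hD c hc
  have h2 := hρ w
  have hxp : x ≠ p := fun h => hp (h ▸ hx)
  simp only [hxp, if_false]
  split_ifs with hxc hxA
  · linarith [hρ0 w hw, hM c hc]
  · linarith [ht x hxA]
  · have hxB : x ∈ B := by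
      rw [← hS] at hx
      simpa [hxc, hxA] using hx
    linarith [hu x hxB]

/-- On the unit sphere, chords are controlled by the differences in polar angle and longitude. -/
theorem dist_le_abs_sub_polar_add_min_azimuth {x y : EuclideanSpace ℝ (Fin 3)}
    (hx : ‖x‖ = 1) (hy : ‖y‖ = 1) :
    dist x y ≤ |Real.arccos (x 2) - Real.arccos (y 2)| +
      min 2 |Complex.arg ⟨x 0, x 1⟩ - Complex.arg ⟨y 0, y 1⟩| := by
  have coords : ∀ z : EuclideanSpace ℝ (Fin 3), ‖z‖ = 1 → ∃ θ φ : ℝ,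
      θ = Real.arccos (z 2) ∧ φ = Complex.arg ⟨z 0, z 1⟩ ∧ 0 ≤ Real.sin θ ∧
      z 0 = Real.sin θ * Real.cos φ ∧ z 1 = Real.sin θ * Real.sin φ ∧ z 2 = Real.cos θ := by
    intro z hz
    have h1 : z 0 ^ 2 + z 1 ^ 2 + z 2 ^ 2 = 1 := by
      have h := EuclideanSpace.real_norm_sq_eq z
      rw [hz, Fin.sum_univ_three] at h
      linarith
    have hs : Real.sin (Real.arccos (z 2)) = ‖(⟨z 0, z 1⟩ : ℂ)‖ := by
      rw [Real.sin_arccos, Complex.norm_def, Complex.normSq_mk]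
      congr 1
      linarith
    refine ⟨_, _, rfl, rfl, hs ▸ norm_nonneg _, ?_, ?_, (Real.cos_arccos ?_ ?_).symm⟩
    · rw [hs, Complex.norm_mul_cos_arg]
    · rw [hs, Complex.norm_mul_sin_arg]
    · nlinarith [sq_nonneg (z 0), sq_nonneg (z 1)]
    · nlinarith [sq_nonneg (z 0), sq_nonneg (z 1)]
  obtain ⟨θ, φ, hθ, hφ, hs, x0, x1, x2⟩ := coords x hx
  obtain ⟨θ', φ', hθ', hφ', hs', y0, y1, y2⟩ := coords y hy
  rw [← hθ, ← hφ, ← hθ', ← hφ', EuclideanSpace.dist_eq, Fin.sum_univ_three]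
  simp only [Real.dist_eq, sq_abs]
  refine Real.sqrt_le_iff.2 ⟨by positivity, ?_⟩
  rw [x0, x1, x2, y0, y1, y2]
  have e : (Real.sin θ * Real.cos φ - Real.sin θ' * Real.cos φ') ^ 2 +
      (Real.sin θ * Real.sin φ - Real.sin θ' * Real.sin φ') ^ 2 +
      (Real.cos θ - Real.cos θ') ^ 2 =
      2 * (1 - Real.cos (θ - θ')) +
        2 * (Real.sin θ * Real.sin θ') * (1 - Real.cos (φ - φ')) := by
    rw [Real.cos_sub, Real.cos_sub]
    linear_combination Real.sin θ ^ 2 * Real.sin_sq_add_cos_sq φ +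
      Real.sin θ' ^ 2 * Real.sin_sq_add_cos_sq φ' + Real.sin_sq_add_cos_sq θ +
      Real.sin_sq_add_cos_sq θ'
  have h1 : 2 * (1 - Real.cos (θ - θ')) ≤ |θ - θ'| ^ 2 := by
    rw [sq_abs]
    linarith [Real.one_sub_sq_div_two_le_cos (x := θ - θ')]
  have hss : Real.sin θ * Real.sin θ' ≤ 1 :=
    mul_le_one₀ (Real.sin_le_one _) hs' (Real.sin_le_one _)
  have h2 : 2 * (Real.sin θ * Real.sin θ') * (1 - Real.cos (φ - φ')) ≤
      (min 2 |φ - φ'|) ^ 2 := by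
    have h3 : 2 * (Real.sin θ * Real.sin θ') * (1 - Real.cos (φ - φ')) ≤
        2 * (1 - Real.cos (φ - φ')) := by
      nlinarith [Real.cos_le_one (φ - φ')]
    refine h3.trans ?_
    rcases min_choice 2 |φ - φ'| with h | h <;> rw [h]
    · linarith [Real.neg_one_le_cos (φ - φ')]
    · rw [sq_abs]
      linarith [Real.one_sub_sq_div_two_le_cos (x := φ - φ')]
  have h4 : 0 ≤ |θ - θ'| * min 2 |φ - φ'| := by positivity
  rw [e]
  nlinarith

/-- any finite set of points on the Euclidean unit sphere of `ℝ³` admits a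
wake-up tree rooted at the origin (the center of the ball) with makespan at most `12.37`. -/
theorem freezeTag_unitSphere_makespan_le (S : Finset (EuclideanSpace ℝ (Fin 3)))
    (hS : ∀ p ∈ S, ‖p‖ = 1) :
    ∃ (parent : EuclideanSpace ℝ (Fin 3) → EuclideanSpace ℝ (Fin 3))
      (t : EuclideanSpace ℝ (Fin 3) → ℝ),
      IsWakeUpTree dist (0 : EuclideanSpace ℝ (Fin 3)) S parent t ∧
      ∀ p ∈ S, t p ≤ 12.37 := by
  have h0 : (0 : EuclideanSpace ℝ (Fin 3)) ∉ S := fun h => by simpa using hS 0 h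
  obtain ⟨f, t, hf, ht⟩ := exists_isWakeUpTree_sweep (d := dist)
    (θ := fun x : EuclideanSpace ℝ (Fin 3) => Real.arccos (x 2))
    (φ := fun x : EuclideanSpace ℝ (Fin 3) => Complex.arg ⟨x 0, x 1⟩)
    (ρ := fun w => min (2 * w) (min (2 + w) (4 + w / 2))) (M := Real.pi) (b := 2)
    (fun w => by grind) (fun w hw => by positivity)
    S 0 (-Real.pi) (2 * Real.pi) 1 h0
    (fun x _ => ⟨(Complex.neg_pi_lt_arg _).le, by linarith [Complex.arg_le_pi ⟨x 0, x 1⟩]⟩)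
    (fun x _ => Real.arccos_le_pi _)
    (fun x hx y hy => dist_le_abs_sub_polar_add_min_azimuth (hS x hx) (hS y hy))
    (fun x hx => by
      rw [dist_zero_left, hS x hx]
      linarith [Real.arccos_nonneg (x 2)])
  refine ⟨f, t, hf, fun p hp => (ht p hp).trans ?_⟩
  have h1 : min (2 * (2 * Real.pi)) (min (2 + 2 * Real.pi) (4 + 2 * Real.pi / 2)) ≤
      4 + 2 * Real.pi / 2 := (min_le_right _ _).trans (min_le_right _ _)
  linarith [Real.pi_lt_d2]
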